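/- Let (G,+) be a torsion-free abelian group and suppose A ⊆ G has the ESS property in G. Then for every n ≥ 1 there exists L ∈ ℕ such that Σ_n(±A) contains no arithmetic progression of length L with nonzero common difference; that is, there do not exist x ∈ G and d ∈ G with d ≠ 0 such that x + i·d ∈ Σ_n(±A) for all i ∈ {0,1,…,L−1}. -/

import Mathlib

open Finset Pointwise

/-- The set of tuples `(a₁,…,a_k) ∈ (±A)^k` with `a₁ + ⋯ + a_k = r` and no proper
nonempty subsum lying in `V`. -/
def ESSsolSet {G : Type*} [AddCommGroup G] (A : Set G) (k : ℕ) (V : Set G) (r : G) :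
    Set (Fin k → G) :=
  {t | (∀ i, t i ∈ A ∪ -A) ∧ (∑ i, t i) = r ∧
    ∀ I : Finset (Fin k), I.Nonempty → I ≠ Finset.univ → (∑ i ∈ I, t i) ∉ V}

/-- `A` has the ESS property in the abelian group `G`. -/
def HasESSProperty {G : Type*} [AddCommGroup G] (A : Set G) : Prop :=
  ∀ k : ℕ, 1 ≤ k → ∃ (n : ℕ) (U V : Finset G), ∀ r : G, r ∉ U →
    (ESSsolSet A k (V : Set G) r).Finite ∧ (ESSsolSet A k (V : Set G) r).ncard ≤ n

/-- `Σ_n(±A) = {a₁ + ⋯ + a_k : 1 ≤ k ≤ n, a₁,…,a_k ∈ ±A}`. -/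
def SigmaPM {G : Type*} [AddCommGroup G] (A : Set G) (n : ℕ) : Set G :=
  {x | ∃ k : ℕ, 1 ≤ k ∧ k ≤ n ∧ ∃ t : Fin k → G, (∀ i, t i ∈ A ∪ -A) ∧ (∑ i, t i) = x}


/-- The `k`-fold sums of elements of `±A`. -/
def SigK {G : Type*} [AddCommGroup G] (A : Set G) (k : ℕ) : Set G :=
  {x | ∃ t : Fin k → G, (∀ i, t i ∈ A ∪ -A) ∧ (∑ i, t i) = x}

lemma sum_mem_SigK {G : Type*} [AddCommGroup G] (A : Set G) {k : ℕ} (t : Fin k → G)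
    (ht : ∀ i, t i ∈ A ∪ -A) (J : Finset (Fin k)) : (∑ i ∈ J, t i) ∈ SigK A J.card := by
  refine ⟨fun i => t (J.equivFin.symm i), fun i => ht _, ?_⟩
  rw [Equiv.sum_comp J.equivFin.symm (fun j : J => t j)]
  exact Finset.sum_coe_sort J t

lemma SigK_energy {G : Type*} [AddCommGroup G] [DecidableEq G]
    (A : Set G) (hA : HasESSProperty A) (k : ℕ) :
    ∃ C : ℕ, ∀ S : Finset G, (∀ s ∈ S, s ∈ SigK A k) → S.card ^ 2 ≤ C * (S + S).card := by
  induction k using Nat.strong_induction_on with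
  | _ k ih =>
  rcases Nat.eq_zero_or_pos k with rfl | hk
  · refine ⟨1, fun S hS => ?_⟩
    have h1 : S ⊆ {0} := by
      intro s hs
      obtain ⟨t, -, h⟩ := hS s hs
      simpa using h.symm
    rcases Finset.subset_singleton_iff.1 h1 with rfl | rfl <;> simp
  have ih' : ∃ C : ℕ, 1 ≤ C ∧ ∀ j < k, ∀ S : Finset G, (∀ s ∈ S, s ∈ SigK A j) →
      S.card ^ 2 ≤ C * (S + S).card := by
    choose! c hc using ih
    refine ⟨1 + ∑ j ∈ range k, c j, by omega, fun j hj S hS => (hc j hj S hS).trans ?_⟩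
    apply Nat.mul_le_mul_right
    have := Finset.single_le_sum (f := c) (fun i _ => Nat.zero_le _) (mem_range.2 hj)
    omega
  obtain ⟨C, hC1, hC⟩ := ih'
  obtain ⟨N, U, V, hN⟩ := hA (k + k) (by omega)
  set B : ℕ := (univ : Finset (Finset (Fin (k + k)))).card * (U ∪ V).card with hB
  refine ⟨2 * N + 4 * B ^ 2 * C, fun S hS => ?_⟩
  rcases S.eq_empty_or_nonempty with rfl | hne
  · simp
  choose! t htA hts using hS
  set F : ℕ := Nat.sqrt (C * (S + S).card) with hF
  have hSS : 0 < (S + S).card := (hne.add hne).card_pos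
  have hF1 : 1 ≤ F := by
    rw [hF, Nat.le_sqrt]
    nlinarith
  have hF2 : F ^ 2 ≤ C * (S + S).card := by rw [pow_two]; exact Nat.sqrt_le _
  have fib : ∀ I : Finset (Fin k), I.Nonempty → ∀ v : G,
      (S.filter (fun s => ∑ i ∈ I, t s i = v)).card ≤ F := by
    intro I hI v
    set S' := S.filter (fun s => ∑ i ∈ I, t s i = v) with hS'
    have hcard : (S'.image (fun s => s - v)).card = S'.card :=
      Finset.card_image_of_injective _ (sub_left_injective)
    have hj : Iᶜ.card < k := by
      rw [Finset.card_compl, Fintype.card_fin]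
      have := hI.card_pos
      omega
    have h := hC Iᶜ.card hj (S'.image (fun s => s - v)) (by
      intro x hx
      obtain ⟨s, hs, rfl⟩ := Finset.mem_image.1 hx
      obtain ⟨hsS, hsv⟩ := Finset.mem_filter.1 hs
      have h1 := sum_mem_SigK A (t s) (htA s hsS) Iᶜ
      have h2 := Finset.sum_add_sum_compl I (t s)
      rw [hts s hsS, hsv] at h2
      have h3 : s - v = ∑ i ∈ Iᶜ, t s i := by
        rw [eq_comm, eq_sub_iff_add_eq, add_comm]; exact h2
      rw [h3]; exact h1)
    have hsub : (S'.image (fun s => s - v) + S'.image (fun s => s - v)).card ≤ (S + S).card := by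
      apply Finset.card_le_card_of_injOn (fun x => x + (v + v))
      · intro x hx
        obtain ⟨a, ha, b, hb, rfl⟩ := Finset.mem_add.1 (Finset.mem_coe.1 hx)
        obtain ⟨s, hs, rfl⟩ := Finset.mem_image.1 ha
        obtain ⟨s', hs', rfl⟩ := Finset.mem_image.1 hb
        have : s - v + (s' - v) + (v + v) = s + s' := by abel
        simp only [this]
        exact Finset.mem_coe.2 (Finset.add_mem_add (Finset.mem_filter.1 hs).1 (Finset.mem_filter.1 hs').1)
      · intro x _ y _ h
        exact add_right_cancel h
    rw [hcard] at h
    rw [hF, Nat.le_sqrt, ← pow_two]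
    exact h.trans (Nat.mul_le_mul_left _ hsub)
  -- bad pairs
  let T : G × G → Fin (k + k) → G := fun p => Fin.append (t p.1) (t p.2)
  have hTsum : ∀ (p : G × G) (I : Finset (Fin (k + k))), ∑ i ∈ I, T p i =
      (∑ i ∈ univ.filter (fun i => Fin.castAdd k i ∈ I), t p.1 i) +
      ∑ i ∈ univ.filter (fun i => Fin.natAdd k i ∈ I), t p.2 i := by
    intro p I
    have : ∑ i ∈ I, T p i = ∑ i, if i ∈ I then T p i else 0 := by simp
    rw [this, Fin.sum_univ_add, Finset.sum_filter, Finset.sum_filter]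
    simp only [T, Fin.append_left, Fin.append_right]
  let bad : Finset (Fin (k + k)) → G → Finset (G × G) := fun I v =>
    (S ×ˢ S).filter (fun p => I.Nonempty ∧ ∑ i ∈ I, T p i = v)
  have hbad : ∀ I v, (bad I v).card ≤ S.card * F := by
    intro I v
    by_cases hI : I.Nonempty
    swap
    · simp [bad, hI]
    have key : (univ.filter (fun i => Fin.castAdd k i ∈ I)).Nonempty ∨
        (univ.filter (fun i => Fin.natAdd k i ∈ I)).Nonempty := by
      obtain ⟨i, hi⟩ := hI
      induction i using Fin.addCases with
      | left i => left; exact ⟨i, by simpa using hi⟩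
      | right i => right; exact ⟨i, by simpa using hi⟩
    rw [mul_comm]
    rcases key with h | h
    · apply Finset.card_le_mul_card_image_of_maps_to (f := Prod.snd)
      · intro p hp
        exact (Finset.mem_product.1 (Finset.mem_filter.1 hp).1).2
      · intro b hb
        refine le_trans ?_ (fib _ h (v - ∑ i ∈ univ.filter (fun i => Fin.natAdd k i ∈ I), t b i))
        apply Finset.card_le_card_of_injOn Prod.fst
        · rintro ⟨a, b'⟩ hp
          simp only [bad, Finset.coe_filter, Finset.mem_filter, Finset.mem_product,
            Set.mem_ofPred_eq] at hp ⊢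
          obtain ⟨⟨⟨ha, -⟩, -, hs⟩, rfl⟩ := hp
          rw [hTsum] at hs
          exact ⟨ha, eq_sub_of_add_eq hs⟩
        · rintro ⟨a, b1⟩ h1 ⟨a', b2⟩ h2 h3
          have e1 := (Finset.mem_filter.1 (Finset.mem_coe.1 h1)).2
          have e2 := (Finset.mem_filter.1 (Finset.mem_coe.1 h2)).2
          simp_all
    · apply Finset.card_le_mul_card_image_of_maps_to (f := Prod.fst)
      · intro p hp
        exact (Finset.mem_product.1 (Finset.mem_filter.1 hp).1).1
      · intro b hb
        refine le_trans ?_ (fib _ h (v - ∑ i ∈ univ.filter (fun i => Fin.castAdd k i ∈ I), t b i))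
        apply Finset.card_le_card_of_injOn Prod.snd
        · rintro ⟨b', a⟩ hp
          simp only [bad, Finset.coe_filter, Finset.mem_filter, Finset.mem_product,
            Set.mem_ofPred_eq] at hp ⊢
          obtain ⟨⟨⟨-, ha⟩, -, hs⟩, rfl⟩ := hp
          rw [hTsum, add_comm] at hs
          exact ⟨ha, eq_sub_of_add_eq hs⟩
        · rintro ⟨b1, a⟩ h1 ⟨b2, a'⟩ h2 h3
          have e1 := (Finset.mem_filter.1 (Finset.mem_coe.1 h1)).2
          have e2 := (Finset.mem_filter.1 (Finset.mem_coe.1 h2)).2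
          simp_all
  let Bad : Finset (G × G) :=
    ((univ : Finset (Finset (Fin (k + k)))) ×ˢ (U ∪ V)).biUnion (fun q => bad q.1 q.2)
  have hBad : Bad.card ≤ B * (S.card * F) := by
    rw [hB, ← Finset.card_product]
    exact Finset.card_biUnion_le_card_mul _ _ _ (fun q _ => hbad q.1 q.2)
  have hnot : ∀ p ∈ (S ×ˢ S) \ Bad, ∀ I : Finset (Fin (k + k)), I.Nonempty →
      ∑ i ∈ I, T p i ∉ U ∪ V := by
    intro p hp I hI hmem
    obtain ⟨hp1, hp2⟩ := Finset.mem_sdiff.1 hp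
    apply hp2
    exact Finset.mem_biUnion.2 ⟨(I, ∑ i ∈ I, T p i), Finset.mem_product.2 ⟨mem_univ _, hmem⟩,
      Finset.mem_filter.2 ⟨hp1, hI, rfl⟩⟩
  have hTtot : ∀ p ∈ S ×ˢ S, ∑ i, T p i = p.1 + p.2 := by
    intro p hp
    rw [hTsum]
    simp [hts _ (Finset.mem_product.1 hp).1, hts _ (Finset.mem_product.1 hp).2]
  have hGood : ((S ×ˢ S) \ Bad).card ≤ N * (S + S).card := by
    apply Finset.card_le_mul_card_image_of_maps_to (f := fun p => p.1 + p.2)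
    · intro p hp
      have h := Finset.mem_product.1 (Finset.mem_sdiff.1 hp).1
      exact Finset.add_mem_add h.1 h.2
    · intro r hr
      set Q := ((S ×ˢ S) \ Bad).filter (fun p => p.1 + p.2 = r) with hQ
      rcases Q.eq_empty_or_nonempty with h0 | ⟨p0, hp0⟩
      · rw [h0]; simp
      have hrU : r ∉ U := by
        obtain ⟨h1, h2⟩ := Finset.mem_filter.1 hp0
        have h3 := hnot p0 h1 univ ⟨⟨0, by omega⟩, mem_univ _⟩
        rw [hTtot p0 (Finset.mem_sdiff.1 h1).1, h2] at h3
        exact fun h => h3 (Finset.mem_union_left _ h)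
      obtain ⟨hfin, hcard⟩ := hN r hrU
      refine le_trans ?_ hcard
      rw [← Set.ncard_coe_finset Q]
      apply Set.ncard_le_ncard_of_injOn T _ _ hfin
      · intro p hp
        obtain ⟨h1, h2⟩ := Finset.mem_filter.1 (Finset.mem_coe.1 hp)
        have h3 := (Finset.mem_sdiff.1 h1).1
        refine ⟨?_, ?_, ?_⟩
        · intro i
          induction i using Fin.addCases with
          | left i => simpa [T] using htA _ (Finset.mem_product.1 h3).1 i
          | right i => simpa only [T, Fin.append_right] using htA _ (Finset.mem_product.1 h3).2 i
        · rw [hTtot p h3, h2]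
        · intro I hI _ hV
          exact hnot p h1 I hI (Finset.mem_union_right _ hV)
      · intro p hp q hq hpq
        have h3 := Finset.mem_product.1
          (Finset.mem_sdiff.1 (Finset.mem_filter.1 (Finset.mem_coe.1 hp)).1).1
        have h4 := Finset.mem_product.1
          (Finset.mem_sdiff.1 (Finset.mem_filter.1 (Finset.mem_coe.1 hq)).1).1
        have e1 : t p.1 = t q.1 := by
          funext i
          simpa [T] using congrFun hpq (Fin.castAdd k i)
        have e2 : t p.2 = t q.2 := by
          funext i
          simpa only [T, Fin.append_right] using congrFun hpq (Fin.natAdd k i)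
        apply Prod.ext
        · rw [← hts _ h3.1, ← hts _ h4.1, e1]
        · rw [← hts _ h3.2, ← hts _ h4.2, e2]
  have htot : S.card ^ 2 ≤ N * (S + S).card + B * (S.card * F) := by
    have h := Finset.card_le_card_sdiff_add_card (s := S ×ˢ S) (t := Bad)
    rw [Finset.card_product, ← pow_two] at h
    omega
  rcases le_or_gt S.card (2 * B * F) with h | h
  · calc S.card ^ 2 ≤ (2 * B * F) ^ 2 := Nat.pow_le_pow_left h 2
      _ = 4 * B ^ 2 * F ^ 2 := by ring
      _ ≤ 4 * B ^ 2 * (C * (S + S).card) := Nat.mul_le_mul_left _ hF2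
      _ ≤ _ := by nlinarith [Nat.zero_le (2 * N * (S + S).card)]
  · have h1 : 2 * B * F * S.card ≤ S.card ^ 2 := by
      rw [pow_two]; exact Nat.mul_le_mul_right _ h.le
    have h2 : S.card ^ 2 ≤ 2 * N * (S + S).card := by nlinarith
    exact h2.trans (Nat.mul_le_mul_right _ (by omega))

/-- from Remark 6.10: if `G` is a torsion-free abelian group and `A ⊆ G` has
the ESS property in `G`, then for every `n ≥ 1` there is `L ∈ ℕ` such that `Σ_n(±A)`
contains no arithmetic progression of length `L` with nonzero common difference. -/
theorem ESS_no_long_arithmetic_progressions {G : Type*} [AddCommGroup G]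
    (htf : ∀ (g : G) (m : ℕ), 0 < m → m • g = 0 → g = 0)
    (A : Set G) (hA : HasESSProperty A) :
    ∀ n : ℕ, 1 ≤ n → ∃ L : ℕ,
      ¬ ∃ (x d : G), d ≠ 0 ∧ ∀ i : ℕ, i < L → x + i • d ∈ SigmaPM A n := by
  classical
  intro n hn
  choose c hc using SigK_energy A hA
  set C := ∑ k ∈ Icc 1 n, c k with hCdef
  refine ⟨2 * C * n ^ 2 + 1, ?_⟩
  set L := 2 * C * n ^ 2 + 1 with hL
  rintro ⟨x, d, hd, hP⟩
  have hinj : Function.Injective (fun i : ℕ => x + i • d) := by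
    have aux : ∀ i j : ℕ, i < j → x + i • d ≠ x + j • d := by
      intro i j hij h
      have h' := add_left_cancel h
      apply hd
      apply htf d (j - i) (by omega)
      have : j • d = (j - i) • d + i • d := by rw [← add_nsmul]; congr 1; omega
      rw [this] at h'
      simpa using h'.symm
    intro i j h
    rcases lt_trichotomy i j with h1 | h1 | h1
    · exact absurd h (aux i j h1)
    · exact h1
    · exact absurd h.symm (aux j i h1)
  set P : Finset G := (range L).image (fun i : ℕ => x + i • d) with hPdef
  have hPcard : P.card = L := by
    rw [hPdef, Finset.card_image_of_injective _ hinj, Finset.card_range]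
  have hPP : (P + P).card ≤ 2 * L := by
    have : P + P ⊆ (range (2 * L)).image (fun i : ℕ => x + x + i • d) := by
      intro y hy
      obtain ⟨a, ha, b, hb, rfl⟩ := Finset.mem_add.1 hy
      obtain ⟨i, hi, rfl⟩ := Finset.mem_image.1 ha
      obtain ⟨j, hj, rfl⟩ := Finset.mem_image.1 hb
      rw [Finset.mem_range] at hi hj
      refine Finset.mem_image.2 ⟨i + j, by rw [Finset.mem_range]; omega, ?_⟩
      simp only [add_nsmul]; abel
    exact (Finset.card_le_card this).trans (Finset.card_image_le.trans (by simp))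
  let S : ℕ → Finset G := fun k => P.filter (fun y => y ∈ SigK A k)
  have hcov : P ⊆ (Icc 1 n).biUnion S := by
    intro y hy
    obtain ⟨i, hi, rfl⟩ := Finset.mem_image.1 hy
    obtain ⟨k, h1, h2, t, ht⟩ := hP i (Finset.mem_range.1 hi)
    exact Finset.mem_biUnion.2 ⟨k, Finset.mem_Icc.2 ⟨h1, h2⟩, Finset.mem_filter.2 ⟨hy, t, ht⟩⟩
  have hbound : ∀ k ∈ Icc 1 n, (S k).card ≤ Nat.sqrt (C * (2 * L)) := by
    intro k hk
    rw [Nat.le_sqrt, ← pow_two]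
    have h1 := hc k (S k) (fun s hs => (Finset.mem_filter.1 hs).2)
    have h2 : (S k + S k).card ≤ 2 * L :=
      (Finset.card_le_card (Finset.add_subset_add (Finset.filter_subset _ _)
        (Finset.filter_subset _ _))).trans hPP
    have h3 : c k ≤ C := Finset.single_le_sum (f := c) (fun i _ => Nat.zero_le _) hk
    exact h1.trans (Nat.mul_le_mul h3 h2)
  have h1 : L ≤ n * Nat.sqrt (C * (2 * L)) := by
    have := (Finset.card_le_card hcov).trans (Finset.card_biUnion_le_card_mul _ _ _ hbound)
    simpa [hPcard] using this
  have h2 : Nat.sqrt (C * (2 * L)) ^ 2 ≤ C * (2 * L) := by rw [pow_two]; exact Nat.sqrt_le _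
  have h3 : L ^ 2 ≤ (2 * C * n ^ 2) * L := by
    calc L ^ 2 ≤ (n * Nat.sqrt (C * (2 * L))) ^ 2 := Nat.pow_le_pow_left h1 2
      _ = n ^ 2 * Nat.sqrt (C * (2 * L)) ^ 2 := by ring
      _ ≤ n ^ 2 * (C * (2 * L)) := Nat.mul_le_mul_left _ h2
      _ = _ := by ring
  have h4 : L ≤ 2 * C * n ^ 2 := by
    rw [pow_two] at h3
    exact Nat.le_of_mul_le_mul_right h3 (by omega)
  omega
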